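/- Let A and B be positive invertible bounded operators on a complex Hilbert space such that A − B ≥ m·I for some m > 0, and let 0 < p ≤ 1. Then B^{−p} − A^{−p} ≥ (‖B‖^{−p} − (‖B‖ + m)^{−p}) · I, and ‖B‖^{−p} − (‖B‖ + m)^{−p} > 0. -/

import Mathlib

/-- The decrements of `t ↦ t ^ (-p)` over intervals of fixed length are antitone on `(0, ∞)`. -/
theorem Real.rpow_neg_sub_rpow_neg_add_le {p m s t : ℝ} (hp : 0 ≤ p) (hm : 0 ≤ m)
    (hs : 0 < s) (hst : s ≤ t) :
    t ^ (-p) - (t + m) ^ (-p) ≤ s ^ (-p) - (s + m) ^ (-p) := by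
  have factor : ∀ u : ℝ, 0 < u →
      u ^ (-p) - (u + m) ^ (-p) = u ^ (-p) * (1 - (u / (u + m)) ^ p) := by
    intro u hu
    have hum : 0 < u + m := by linarith
    have hup : u ^ p ≠ 0 := (Real.rpow_pos_of_pos hu p).ne'
    have hump : (u + m) ^ p ≠ 0 := (Real.rpow_pos_of_pos hum p).ne'
    rw [Real.div_rpow hu.le hum.le, Real.rpow_neg hu.le, Real.rpow_neg hum.le]
    field_simp
  have ht : 0 < t := hs.trans_le hst
  rw [factor s hs, factor t ht]
  have htm : 0 < t + m := by linarith
  have hsm : 0 < s + m := by linarith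
  refine mul_le_mul (Real.rpow_le_rpow_of_nonpos hs hst (by linarith)) ?_ ?_
    (Real.rpow_nonneg hs.le _)
  · refine sub_le_sub_left (Real.rpow_le_rpow (by positivity) ?_ hp) 1
    rw [div_le_div_iff₀ hsm htm]
    nlinarith
  · refine sub_nonneg.2 (Real.rpow_le_one (by positivity) ?_ hp)
    rw [div_le_one htm]
    linarith

/-- `a ↦ a ^ (-p)` is operator antitone for `p ∈ [0, 1]`. -/
theorem CFC.rpow_neg_le_rpow_neg {𝓐 : Type*} [CStarAlgebra 𝓐] [PartialOrder 𝓐]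
    [StarOrderedRing 𝓐] {a b : 𝓐} {p : ℝ} (hp : p ∈ Set.Icc 0 1) (ha : IsStrictlyPositive a)
    (hab : a ≤ b) : b ^ (-p) ≤ a ^ (-p) := by
  have hb : IsStrictlyPositive b := ha.of_le hab
  have h := CFC.rpow_le_rpow hp (CStarAlgebra.rpow_neg_one_le_rpow_neg_one hab ha)
  rwa [CFC.rpow_rpow b _ _ (by norm_num) hb, CFC.rpow_rpow a _ _ (by norm_num) ha,
    neg_one_mul] at h

theorem CFC.algebraMap_le_rpow_neg_sub_rpow_neg {𝓐 : Type*} [CStarAlgebra 𝓐] [PartialOrder 𝓐]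
    [StarOrderedRing 𝓐] {a b : 𝓐} {p m : ℝ} (hp : p ∈ Set.Icc 0 1) (hm : 0 ≤ m)
    (hb : IsStrictlyPositive b) (hab : b + algebraMap ℝ 𝓐 m ≤ a) :
    algebraMap ℝ 𝓐 (‖b‖ ^ (-p) - (‖b‖ + m) ^ (-p)) ≤ b ^ (-p) - a ^ (-p) := by
  nontriviality 𝓐
  have hbm : IsStrictlyPositive (b + algebraMap ℝ 𝓐 m) :=
    hb.add_nonneg (algebraMap_nonneg 𝓐 hm)
  have hpos : ∀ x ∈ spectrum ℝ b, 0 < x := fun x hx => hb.spectrum_pos hx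
  have hcont : ContinuousOn (fun x : ℝ => x ^ (-p)) (spectrum ℝ b) := fun x hx =>
    (Real.continuousAt_rpow_const x _ (.inl (hpos x hx).ne')).continuousWithinAt
  have hcont' : ContinuousOn (fun x : ℝ => (x + m) ^ (-p)) (spectrum ℝ b) :=
    ContinuousOn.rpow_const (by fun_prop) fun x hx => .inl (by linarith [hpos x hx])
  have hshift : cfc (fun x : ℝ => x + m) b = b + algebraMap ℝ 𝓐 m := by
    rw [cfc_add_const m (fun x => x) b, cfc_id' ℝ b]
  have hcont_image : ContinuousOn (fun x : ℝ => x ^ (-p)) ((fun x => x + m) '' spectrum ℝ b) := by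
    rintro _ ⟨x, hx, rfl⟩
    exact (Real.continuousAt_rpow_const _ _
      (.inl (by linarith [hpos x hx]))).continuousWithinAt
  have hrpow : (b + algebraMap ℝ 𝓐 m) ^ (-p) = cfc (fun x : ℝ => (x + m) ^ (-p)) b := by
    rw [CFC.rpow_eq_cfc_real hbm.nonneg, ← hshift,
      cfc_comp' (fun x : ℝ => x ^ (-p)) (fun x => x + m) b hcont_image]
  calc algebraMap ℝ 𝓐 (‖b‖ ^ (-p) - (‖b‖ + m) ^ (-p))
      ≤ cfc (fun x : ℝ => x ^ (-p) - (x + m) ^ (-p)) b :=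
        algebraMap_le_cfc _ _ b (fun x hx => Real.rpow_neg_sub_rpow_neg_add_le hp.1 hm (hpos x hx)
          ((Real.le_norm_self x).trans (spectrum.norm_le_norm_of_mem hx))) (hcont.sub hcont')
    _ = b ^ (-p) - (b + algebraMap ℝ 𝓐 m) ^ (-p) := by
        rw [cfc_sub _ _ b hcont hcont', hrpow, CFC.rpow_eq_cfc_real hb.nonneg]
    _ ≤ b ^ (-p) - a ^ (-p) := sub_le_sub_left (CFC.rpow_neg_le_rpow_neg hp hbm hab) _

theorem rpow_inverse_difference_lower_bound
    {H : Type*} [NormedAddCommGroup H] [InnerProductSpace ℂ H] [CompleteSpace H] [Nontrivial H]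
    (A B : H →L[ℂ] H) (hA : IsSelfAdjoint A) (hB : IsSelfAdjoint B)
    (hApos : 0 ≤ A) (hBpos : 0 ≤ B) (hAinv : IsUnit A) (hBinv : IsUnit B)
    (m : ℝ) (hm : 0 < m) (hAB : m • (1 : H →L[ℂ] H) ≤ A - B)
    (p : ℝ) (hp0 : 0 < p) (hp1 : p ≤ 1) :
    (‖B‖ ^ (-p) - (‖B‖ + m) ^ (-p)) • (1 : H →L[ℂ] H) ≤
      CFC.rpow B (-p) - CFC.rpow A (-p) ∧
    0 < ‖B‖ ^ (-p) - (‖B‖ + m) ^ (-p) := by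
  constructor
  · rw [← Algebra.algebraMap_eq_smul_one] at hAB ⊢
    exact CFC.algebraMap_le_rpow_neg_sub_rpow_neg ⟨hp0.le, hp1⟩ hm.le
      (hBinv.isStrictlyPositive hBpos) (le_sub_iff_add_le'.1 hAB)
  · have hnorm : 0 < ‖B‖ := norm_pos_iff.2 hBinv.ne_zero
    exact sub_pos.2 (Real.rpow_lt_rpow_of_neg hnorm (by linarith) (by linarith))
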